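/- Let k ≥ 2 be an even integer and let m, n be integers with n ≥ m ≥ (k+2)² + 3. Then K(m−3,k)·K(n−3,k) ≤ k·K(m+n−3,k); equivalently, the sequence a_n := log₂(K(n−3,k)/k) satisfies a_m + a_n ≤ a_{m+n} for all such m, n, i.e., log₂ K(d−3,k) is superadditive in d up to an additive constant. -/

import Mathlib

/-- Cyclic distance between two indices on a cycle of length `N`. -/
def cycDist {N : ℕ} (i j : ZMod N) : ℕ := min (j - i).val (i - j).val

/-- A `(d,k)` circuit code of length `N`: a simple cycle `x₁,…,x_N` in the
`d`-dimensional hypercube graph `I(d)` (vertices are binary vectors of length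
`d`, adjacency is Hamming distance `1`, and the graph distance in `I(d)` equals
the Hamming distance) such that for any two vertices of the cycle the graph
distance is at least the minimum of their distance along the cycle and `k`. -/
def IsCircuitCode (d k N : ℕ) (x : ZMod N → (Fin d → Bool)) : Prop :=
  3 ≤ N ∧ Function.Injective x ∧
    (∀ i : ZMod N, hammingDist (x i) (x (i + 1)) = 1) ∧
    (∀ i j : ZMod N, min (cycDist i j) k ≤ hammingDist (x i) (x j))

/-- `K d k`: the maximum length of a `(d,k)` circuit code. -/
noncomputable def K (d k : ℕ) : ℕ :=
  sSup {N | ∃ x : ZMod N → (Fin d → Bool), IsCircuitCode d k N x}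

/-- A `(d,k)` circuit code of length `N`, traversed as an `N`-periodic sequence. -/
structure IsPeriodicCode (d k N : ℕ) (g : ℕ → Fin d → Bool) : Prop where
  periodic : ∀ n, g (n + N) = g n
  step : ∀ n, hammingDist (g n) (g (n + 1)) = 1
  spread : ∀ n t, t ≤ N → min (min t (N - t)) k ≤ hammingDist (g n) (g (n + t))

lemma cycDist_comm {N : ℕ} (i j : ZMod N) : cycDist i j = cycDist j i := min_comm _ _

lemma cycDist_natCast_add {N : ℕ} [NeZero N] (n t : ℕ) (ht : t ≤ N) :
    cycDist (n : ZMod N) ((n + t : ℕ) : ZMod N) = min t (N - t) := by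
  rcases ht.eq_or_lt with rfl | h
  · simp [cycDist]
  · have h1 : (((n + t : ℕ) : ZMod N) - (n : ZMod N)) = (t : ZMod N) := by push_cast; ring
    have h2 : ((n : ZMod N) - ((n + t : ℕ) : ZMod N)) = -(t : ZMod N) := by push_cast; ring
    have h3 : ((t : ℕ) : ZMod N).val = t := ZMod.val_cast_of_lt h
    rw [cycDist, h1, h2, h3, ZMod.neg_val, h3]
    split_ifs with h0
    · rw [← ZMod.val_eq_zero, h3] at h0
      omega
    · rfl

lemma IsCircuitCode.isPeriodicCode {d k N : ℕ} {x : ZMod N → Fin d → Bool}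
    (h : IsCircuitCode d k N x) : IsPeriodicCode d k N (fun n => x n) := by
  obtain ⟨h3, -, hs, hd⟩ := h
  have : NeZero N := ⟨by omega⟩
  refine ⟨fun n => by simp, fun n => by simpa using hs n, fun n t ht => ?_⟩
  rw [← cycDist_natCast_add n t ht]
  exact hd _ _

lemma IsPeriodicCode.isCircuitCode {d k N : ℕ} {g : ℕ → Fin d → Bool}
    (h : IsPeriodicCode d k N g) (hN : 3 ≤ N) (hk : 1 ≤ k) :
    IsCircuitCode d k N (fun i => g i.val) := by
  have : NeZero N := ⟨by omega⟩
  have hd : ∀ i j : ZMod N, min (cycDist i j) k ≤ hammingDist (g i.val) (g j.val) := by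
    intro i j
    wlog hij : i.val ≤ j.val generalizing i j
    · rw [cycDist_comm, hammingDist_comm]
      exact this j i (by omega)
    have hj := ZMod.val_lt j
    have key := h.spread i.val (j.val - i.val) (by omega)
    have e : i.val + (j.val - i.val) = j.val := by omega
    rw [← cycDist_natCast_add i.val _ (by omega), e] at key
    simpa using key
  refine ⟨hN, fun i j hij => ?_, fun i => ?_, hd⟩
  · have := hd i j
    have hij' : g i.val = g j.val := hij
    rw [hij', hammingDist_self] at this
    have h0 : cycDist i j = 0 := by omega
    rw [cycDist] at h0
    have : (j - i).val = 0 ∨ (i - j).val = 0 := by omega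
    simp only [ZMod.val_eq_zero, sub_eq_zero] at this
    exact this.elim Eq.symm id
  · rcases (show i.val + 1 < N ∨ i.val + 1 = N by have := ZMod.val_lt i; omega) with hi | hi
    · have : (i + 1).val = i.val + 1 := by
        rw [ZMod.val_add, ZMod.val_one'' (by omega), Nat.mod_eq_of_lt hi]
      simpa [this] using h.step i.val
    · have : (i + 1).val = 0 := by
        rw [ZMod.val_add, ZMod.val_one'' (by omega), hi, Nat.mod_self]
      have hs := h.step i.val
      rw [hi] at hs
      have hp := h.periodic 0
      rw [zero_add] at hp
      simpa [this, hp] using hs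

lemma bddAbove_circuitCode_lengths (d k : ℕ) :
    BddAbove {N | ∃ x : ZMod N → (Fin d → Bool), IsCircuitCode d k N x} := by
  refine ⟨2 ^ d, ?_⟩
  rintro N ⟨x, h3, hinj, -⟩
  have : NeZero N := ⟨by omega⟩
  simpa using Fintype.card_le_of_injective x hinj

lemma IsPeriodicCode.le_K {d k N : ℕ} {g : ℕ → Fin d → Bool}
    (h : IsPeriodicCode d k N g) (hN : 3 ≤ N) (hk : 1 ≤ k) : N ≤ K d k :=
  le_csSup (bddAbove_circuitCode_lengths d k) ⟨_, h.isCircuitCode hN hk⟩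

/-- The cycle of length `2d` that flips the coordinates cyclically has spread `d`. -/
lemma exists_isPeriodicCode_two_mul (d : ℕ) (hd : 1 ≤ d) :
    ∃ g : ℕ → Fin d → Bool, IsPeriodicCode d d (2 * d) g := by
  let g : ℕ → Fin d → Bool := fun n j => decide (((n + j) / d) % 2 = 1)
  have hhalf : ∀ n j, g (n + d) j = !g n j := by
    intro n j
    have : (n + d + j) / d = (n + j) / d + 1 := by
      rw [← Nat.add_div_right _ hd]; congr 1; ring
    simp only [g, this]
    by_cases h : ((n + j) / d) % 2 = 1
    · have : ((n + j) / d + 1) % 2 ≠ 1 := by omega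
      simp [h, this]
    · have : ((n + j) / d + 1) % 2 = 1 := by omega
      simp [h, this]
  have hper : ∀ n, g (n + 2 * d) = g n := by
    intro n
    ext j
    rw [two_mul, ← add_assoc, hhalf, hhalf, Bool.not_not]
  have hstep : ∀ n, hammingDist (g n) (g (n + 1)) = 1 := by
    intro n
    have hn := Nat.mod_lt n hd
    rw [hammingDist, Finset.card_eq_one]
    refine ⟨⟨d - 1 - n % d, by omega⟩, ?_⟩
    ext j
    have hj := j.isLt
    have hdvd : d ∣ n + j + 1 ↔ (j : ℕ) = d - 1 - n % d := by
      have e : n + j + 1 = d * (n / d) + (n % d + j + 1) := by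
        have := Nat.div_add_mod n d; omega
      rw [e, Nat.dvd_add_right (Dvd.intro _ rfl)]
      constructor
      · rintro ⟨q, hq⟩
        have : q = 1 := by
          rcases q with _ | _ | q
          · omega
          · rfl
          · exfalso; nlinarith
        subst this; omega
      · intro h
        exact ⟨1, by omega⟩
    have hs : (n + 1 + j) / d = (n + j) / d + if d ∣ n + j + 1 then 1 else 0 := by
      rw [show n + 1 + j = n + j + 1 by ring, Nat.succ_div]
    simp only [Finset.mem_filter, Finset.mem_univ, true_and, Finset.mem_singleton, Fin.ext_iff,
      ← hdvd, g, hs]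
    split_ifs with h
    · simp only [h, iff_true, ne_eq, decide_eq_decide]; omega
    · simp [h]
  have hle : ∀ n t, hammingDist (g n) (g (n + t)) ≤ t := by
    intro n t
    induction t with
    | zero => simp
    | succ t ih =>
      refine (hammingDist_triangle _ (g (n + t)) _).trans ?_
      exact Nat.add_le_add ih (hstep (n + t)).le
  have hanti : ∀ n, hammingDist (g n) (g (n + d)) = d := by
    intro n
    simp [hammingDist, hhalf]
  have hlow : ∀ n t, t ≤ d → t ≤ hammingDist (g n) (g (n + t)) := by
    intro n t ht
    have h1 := hammingDist_triangle (g n) (g (n + t)) (g (n + d))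
    have h2 := hle (n + t) (d - t)
    rw [show n + t + (d - t) = n + d by omega] at h2
    rw [hanti] at h1
    omega
  refine ⟨g, hper, hstep, fun n t ht => ?_⟩
  rcases le_total t d with h | h
  · have := hlow n t h; omega
  · have := hlow (n + t) (2 * d - t) (by omega)
    rw [show n + t + (2 * d - t) = n + 2 * d by omega, hper, hammingDist_comm] at this
    omega

lemma IsPeriodicCode.mono_spread {d k k' N : ℕ} {g : ℕ → Fin d → Bool}
    (h : IsPeriodicCode d k N g) (hk : k' ≤ k) : IsPeriodicCode d k' N g :=
  ⟨h.periodic, h.step, fun n t ht => (min_le_min_left _ hk).trans (h.spread n t ht)⟩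

lemma two_mul_le_K {d k : ℕ} (hk : 1 ≤ k) (hkd : k ≤ d) (hd : 2 ≤ d) : 2 * d ≤ K d k := by
  obtain ⟨g, hg⟩ := exists_isPeriodicCode_two_mul d (by omega)
  exact (hg.mono_spread hkd).le_K (by omega) hk

lemma exists_isPeriodicCode_K {d k : ℕ} (hk : 1 ≤ k) (hkd : k ≤ d) (hd : 2 ≤ d) :
    ∃ g, IsPeriodicCode d k (K d k) g := by
  obtain ⟨g, hg⟩ := exists_isPeriodicCode_two_mul d (by omega)
  obtain ⟨x, hx⟩ := Nat.sSup_mem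
    (s := {N | ∃ x : ZMod N → (Fin d → Bool), IsCircuitCode d k N x})
    ⟨_, _, (hg.mono_spread hkd).isCircuitCode (by omega) hk⟩ (bddAbove_circuitCode_lengths d k)
  exact ⟨_, hx.isPeriodicCode⟩

lemma hammingDist_append {p q : ℕ} (u u' : Fin p → Bool) (v v' : Fin q → Bool) :
    hammingDist (Fin.append u v) (Fin.append u' v') = hammingDist u u' + hammingDist v v' := by
  simp [hammingDist, Finset.card_filter, Fin.sum_univ_add]

/-- The point `(a, b, c)` lies on the `r`-th stair of the monotone lattice path with corners
`(A r, B r, C r)`; each stair runs first in the first, then in the third, and then in the second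
direction. -/
def OnStair (A B C : ℕ → ℕ) (r a b c : ℕ) : Prop :=
  (A r ≤ a ∧ a ≤ A (r + 1) ∧ b = B r ∧ c = C r) ∨
    (a = A (r + 1) ∧ B r ≤ b ∧ b ≤ B (r + 1) ∧ C r ≤ c ∧ c ≤ C (r + 1) ∧
      (b = B r ∨ c = C (r + 1)))

lemma OnStair.bounds {A B C : ℕ → ℕ} {r a b c : ℕ} (hA : Monotone A) (hB : Monotone B)
    (hC : Monotone C) (h : OnStair A B C r a b c) :
    (A r ≤ a ∧ a ≤ A (r + 1)) ∧ (B r ≤ b ∧ b ≤ B (r + 1)) ∧ (C r ≤ c ∧ c ≤ C (r + 1)) := by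
  have h1 := hA r.le_succ
  have h2 := hB r.le_succ
  have h3 := hC r.le_succ
  simp only [Nat.succ_eq_add_one] at h1 h2 h3
  rcases h with h | h <;> omega

lemma OnStair.unique {A B C : ℕ → ℕ} {r a b c r' a' b' c' : ℕ} (hA : Monotone A)
    (hB : Monotone B) (hC : Monotone C) (h : OnStair A B C r a b c)
    (h' : OnStair A B C r' a' b' c') (hs : a + b + c = a' + b' + c') :
    a = a' ∧ b = b' ∧ c = c' := by
  wlog hr : r ≤ r' generalizing r a b c r' a' b' c'
  · obtain ⟨h1, h2, h3⟩ := this h' h hs.symm (by omega)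
    exact ⟨h1.symm, h2.symm, h3.symm⟩
  rcases hr.eq_or_lt with rfl | hr
  · rcases h with h | h <;> rcases h' with h' | h' <;> omega
  · have h1 := h.bounds hA hB hC
    have h2 := h'.bounds hA hB hC
    have h3 := hA (show r + 1 ≤ r' from hr)
    have h4 := hB (show r + 1 ≤ r' from hr)
    have h5 := hC (show r + 1 ≤ r' from hr)
    omega

lemma OnStair.exists_succ {A B C : ℕ → ℕ} {r a b c : ℕ} (hA : StrictMono A) (hB : Monotone B)
    (hC : Monotone C) (h : OnStair A B C r a b c) :
    ∃ r', OnStair A B C r' (a + 1) b c ∨ OnStair A B C r' a (b + 1) c ∨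
      OnStair A B C r' a b (c + 1) := by
  have hB' := hB r.le_succ
  have hC' := hC r.le_succ
  have hA' := hA (r + 1).lt_succ_self
  simp only [Nat.succ_eq_add_one] at hA' hB' hC'
  by_cases h1 : a < A (r + 1)
  · refine ⟨r, .inl (.inl ?_)⟩
    rcases h with h | h <;> omega
  by_cases h2 : c < C (r + 1)
  · refine ⟨r, .inr (.inr (.inr ?_))⟩
    rcases h with h | h <;> omega
  by_cases h3 : b < B (r + 1)
  · refine ⟨r, .inr (.inl (.inr ?_))⟩
    rcases h with h | h <;> omega
  · refine ⟨r + 1, .inl (.inl ?_)⟩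
    rcases h with h | h <;> omega

/-- The corners of a staircase that, after `R` stairs, closes up in the torus
`ℤ/N₁ × ℤ/N₂ × ℤ/6`, and whose stairs are far enough apart to give spread `k`. -/
structure IsStaircase (k R N₁ N₂ M₁ M₃ : ℕ) (A B C : ℕ → ℕ) : Prop where
  zero : A 0 = 0 ∧ B 0 = 0 ∧ C 0 = 0
  period₁ : ∀ r, A (r + R) = A r + M₁ * N₁
  period₂ : ∀ r, B (r + R) = B r + N₂
  period₃ : ∀ r, C (r + R) = C r + M₃ * 6
  lower₁ : ∀ r, 2 * A r + N₁ + k ≤ 2 * A (r + 1)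
  upper₁ : ∀ r, A (r + 1) + k ≤ A r + N₁
  lower₂ : ∀ r, B r + k ≤ B (r + 1) + 1
  upper₂ : ∀ r, 3 * B (r + 1) + k ≤ 3 * B r + N₂
  lower₃ : ∀ r, C r + 1 ≤ C (r + 1)
  upper₃ : ∀ r, C (r + 1) ≤ C r + 2

namespace IsStaircase

variable {k R N₁ N₂ M₁ M₃ : ℕ} {A B C : ℕ → ℕ}

lemma strictMono₁ (h : IsStaircase k R N₁ N₂ M₁ M₃ A B C) (hk : 2 ≤ k) : StrictMono A :=
  strictMono_nat_of_lt_succ fun r => by have := h.lower₁ r; omega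

lemma strictMono₂ (h : IsStaircase k R N₁ N₂ M₁ M₃ A B C) (hk : 2 ≤ k) : StrictMono B :=
  strictMono_nat_of_lt_succ fun r => by have := h.lower₂ r; omega

lemma strictMono₃ (h : IsStaircase k R N₁ N₂ M₁ M₃ A B C) : StrictMono C :=
  strictMono_nat_of_lt_succ fun r => by have := h.lower₃ r; omega

lemma exists_onStair (h : IsStaircase k R N₁ N₂ M₁ M₃ A B C) (hk : 2 ≤ k) (t : ℕ) :
    ∃ r a b c, OnStair A B C r a b c ∧ a + b + c = t := by
  induction t with
  | zero =>
    obtain ⟨h1, h2, h3⟩ := h.zero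
    exact ⟨0, 0, 0, 0, .inl (by omega), rfl⟩
  | succ t ih =>
    obtain ⟨r, a, b, c, hP, rfl⟩ := ih
    obtain ⟨r', hQ | hQ | hQ⟩ := hP.exists_succ (h.strictMono₁ hk) (h.strictMono₂ hk).monotone
      h.strictMono₃.monotone
    · exact ⟨r', _, _, _, hQ, by ring⟩
    · exact ⟨r', _, _, _, hQ, by ring⟩
    · exact ⟨r', _, _, _, hQ, by ring⟩

lemma onStair_add_period (h : IsStaircase k R N₁ N₂ M₁ M₃ A B C) {r a b c : ℕ}
    (hP : OnStair A B C r a b c) :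
    OnStair A B C (r + R) (a + M₁ * N₁) (b + N₂) (c + M₃ * 6) := by
  unfold OnStair at *
  rw [show r + R + 1 = r + 1 + R by ring]
  simp only [h.period₁, h.period₂, h.period₃]
  omega

end IsStaircase

namespace IsPeriodicCode

lemma add_mul_period {d k N : ℕ} {g : ℕ → Fin d → Bool} (h : IsPeriodicCode d k N g) (n M : ℕ) :
    g (n + M * N) = g n := by
  induction M with
  | zero => simp
  | succ M ih => rw [Nat.succ_mul, ← add_assoc, h.periodic, ih]

lemma spread_of_le {d k N : ℕ} {g : ℕ → Fin d → Bool} (h : IsPeriodicCode d k N g) {a a' : ℕ}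
    (h1 : a ≤ a') (h2 : a' ≤ a + N) :
    min (min (a' - a) (a + N - a')) k ≤ hammingDist (g a) (g a') := by
  have := h.spread a (a' - a) (by omega)
  rw [show a + (a' - a) = a' by omega] at this
  omega

end IsPeriodicCode

lemma IsStaircase.spread_near {k R N₁ N₂ M₁ M₃ d₁ d₂ : ℕ} {A B C : ℕ → ℕ}
    (h : IsStaircase k R N₁ N₂ M₁ M₃ A B C) (hk : 2 ≤ k)
    {g₁ : ℕ → Fin d₁ → Bool} {g₂ : ℕ → Fin d₂ → Bool} {g₃ : ℕ → Fin 3 → Bool}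
    (h₁ : IsPeriodicCode d₁ k N₁ g₁) (h₂ : IsPeriodicCode d₂ k N₂ g₂)
    (h₃ : IsPeriodicCode 3 3 6 g₃) {r a b c δ a' b' c' : ℕ}
    (hP : OnStair A B C r a b c) (hQ : OnStair A B C (r + δ) a' b' c') (hδ : δ ≤ 2)
    (hs : a + b + c ≤ a' + b' + c') :
    min (a' + b' + c' - (a + b + c)) k ≤
      hammingDist (g₁ a) (g₁ a') + hammingDist (g₂ b) (g₂ b') + hammingDist (g₃ c) (g₃ c') := by
  have l10 := h.lower₁ r
  have l11 := h.lower₁ (r + 1)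
  have l12 := h.lower₁ (r + 2)
  have u10 := h.upper₁ r
  have u11 := h.upper₁ (r + 1)
  have u12 := h.upper₁ (r + 2)
  have l20 := h.lower₂ r
  have l21 := h.lower₂ (r + 1)
  have l22 := h.lower₂ (r + 2)
  have u20 := h.upper₂ r
  have u21 := h.upper₂ (r + 1)
  have u22 := h.upper₂ (r + 2)
  have l30 := h.lower₃ r
  have l31 := h.lower₃ (r + 1)
  have l32 := h.lower₃ (r + 2)
  have u30 := h.upper₃ r
  have u31 := h.upper₃ (r + 1)
  have u32 := h.upper₃ (r + 2)
  have hP' := hP.bounds (h.strictMono₁ hk).monotone (h.strictMono₂ hk).monotone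
    h.strictMono₃.monotone
  have hQ' := hQ.bounds (h.strictMono₁ hk).monotone (h.strictMono₂ hk).monotone
    h.strictMono₃.monotone
  unfold OnStair at hP hQ
  simp only [add_assoc, Nat.reduceAdd] at *
  obtain rfl | rfl | rfl : δ = 0 ∨ δ = 1 ∨ δ = 2 := by omega
  · simp only [add_zero, zero_add] at *
    have e1 := h₁.spread_of_le (a := a) (a' := a') (by omega) (by omega)
    have e2 := h₂.spread_of_le (a := b) (a' := b') (by omega) (by omega)
    have e3 := h₃.spread_of_le (a := c) (a' := c') (by omega) (by omega)
    omega
  · simp only [Nat.reduceAdd] at *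
    have e2 := h₂.spread_of_le (a := b) (a' := b') (by omega) (by omega)
    have e3 := h₃.spread_of_le (a := c) (a' := c') (by omega) (by omega)
    rcases hP with hP | hP
    · clear hs hP'
      rcases hQ with hQ | hQ <;> omega
    · have e1 := h₁.spread_of_le (a := a) (a' := a') (by omega) (by omega)
      rcases hQ with hQ | hQ <;> omega
  · simp only [Nat.reduceAdd] at *
    have e2 := h₂.spread_of_le (a := b) (a' := b') (by omega) (by omega)
    have e3 := h₃.spread_of_le (a := c) (a' := c') (by omega) (by omega)
    rcases hQ with hQ | hQ
    · omega
    · rcases hP with hP | hP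
      · omega
      · have e1 := h₁.spread_of_le (a := a + N₁) (a' := a') (by omega) (by omega)
        rw [h₁.periodic] at e1
        omega

lemma IsStaircase.exists_isPeriodicCode {k R N₁ N₂ M₁ M₃ d₁ d₂ : ℕ} {A B C : ℕ → ℕ}
    (h : IsStaircase k R N₁ N₂ M₁ M₃ A B C) (hk : 2 ≤ k)
    {g₁ : ℕ → Fin d₁ → Bool} {g₂ : ℕ → Fin d₂ → Bool} {g₃ : ℕ → Fin 3 → Bool}
    (h₁ : IsPeriodicCode d₁ k N₁ g₁) (h₂ : IsPeriodicCode d₂ k N₂ g₂)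
    (h₃ : IsPeriodicCode 3 3 6 g₃) :
    ∃ g, IsPeriodicCode (d₁ + d₂ + 3) k (M₁ * N₁ + N₂ + M₃ * 6) g := by
  have mA := (h.strictMono₁ hk).monotone
  have mB := (h.strictMono₂ hk).monotone
  have mC := h.strictMono₃.monotone
  choose r a b c hP hs using h.exists_onStair hk
  refine ⟨fun t => Fin.append (Fin.append (g₁ (a t)) (g₂ (b t))) (g₃ (c t)), ?_, ?_, ?_⟩
  · intro n
    obtain ⟨e1, e2, e3⟩ := (hP (n + (M₁ * N₁ + N₂ + M₃ * 6))).unique mA mB mC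
      (h.onStair_add_period (hP n)) (by rw [hs]; have := hs n; omega)
    simp only [e1, e2, e3, h₁.add_mul_period, h₂.periodic, h₃.add_mul_period]
  · intro n
    have hn := hs n
    have hn' := hs (n + 1)
    simp only [hammingDist_append]
    obtain ⟨r', hQ | hQ | hQ⟩ := (hP n).exists_succ (h.strictMono₁ hk) mB mC
    all_goals
      obtain ⟨e1, e2, e3⟩ := (hP (n + 1)).unique mA mB mC hQ (by omega)
      simp [e1, e2, e3, h₁.step, h₂.step, h₃.step]
  · intro n t ht
    simp only [hammingDist_append]
    have hn := hs n
    have hn' := hs (n + t)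
    rcases Nat.eq_zero_or_pos t with rfl | ht0
    · simp
    rcases ht.eq_or_lt with rfl | htL
    · simp
    have b1 := (hP n).bounds mA mB mC
    have b2 := (hP (n + t)).bounds mA mB mC
    have hr : r n ≤ r (n + t) := by
      by_contra! hlt
      have h1 := mA (show r (n + t) + 1 ≤ r n from hlt)
      have h2 := mB (show r (n + t) + 1 ≤ r n from hlt)
      have h3 := mC (show r (n + t) + 1 ≤ r n from hlt)
      omega
    have hrR : r (n + t) ≤ r n + R := by
      by_contra! hlt
      have h1 := mA (show r n + 1 + R ≤ r (n + t) by omega)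
      have h2 := mB (show r n + 1 + R ≤ r (n + t) by omega)
      have h3 := mC (show r n + 1 + R ≤ r (n + t) by omega)
      rw [h.period₁] at h1
      rw [h.period₂] at h2
      rw [h.period₃] at h3
      omega
    by_cases hnear : r (n + t) ≤ r n + 2
    · have := h.spread_near hk h₁ h₂ h₃ (hP n) (r := r n) (δ := r (n + t) - r n)
        (a' := a (n + t)) (b' := b (n + t)) (c' := c (n + t))
        (by rw [Nat.add_sub_cancel' hr]; exact hP (n + t)) (by omega) (by omega)
      omega
    by_cases hfar : r n + R ≤ r (n + t) + 2
    · have := h.spread_near hk h₁ h₂ h₃ (hP (n + t)) (δ := r n + R - r (n + t))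
        (a' := a n + M₁ * N₁) (b' := b n + N₂) (c' := c n + M₃ * 6)
        (by rw [Nat.add_sub_cancel' hrR]; exact h.onStair_add_period (hP n))
        (by omega) (by omega)
      rw [h₁.add_mul_period, h₂.periodic, h₃.add_mul_period, hammingDist_comm,
        hammingDist_comm (g₂ _), hammingDist_comm (g₃ _)] at this
      omega
    · have l1 := h.lower₂ (r n + 1)
      have l2 := h.lower₂ (r n + 1 + 1)
      have l3 := mB (show r n + 1 + 1 + 1 ≤ r (n + t) by omega)
      have l4 := h.lower₂ (r (n + t) + 1)
      have l5 := h.lower₂ (r (n + t) + 1 + 1)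
      have l6 := mB (show r (n + t) + 1 + 1 + 1 ≤ r n + R by omega)
      rw [h.period₂] at l6
      have := h₂.spread_of_le (a := b n) (a' := b (n + t)) (by omega) (by omega)
      omega

lemma beatty_add_le {p R u : ℕ} (hR : 0 < R) (hu : p ≤ R * u) (r : ℕ) :
    (r + 1) * p / R ≤ r * p / R + u := by
  rw [← Nat.add_mul_div_left _ _ hR]
  exact Nat.div_le_div_right (by linarith)

lemma add_le_beatty {p R l : ℕ} (hR : 0 < R) (hl : R * l ≤ p) (r : ℕ) :
    r * p / R + l ≤ (r + 1) * p / R := by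
  rw [← Nat.add_mul_div_left _ _ hR]
  exact Nat.div_le_div_right (by linarith)

lemma beatty_add_period {p R : ℕ} (hR : 0 < R) (r : ℕ) :
    (r + R) * p / R = r * p / R + p := by
  rw [← Nat.add_mul_div_left _ _ hR, add_mul]

lemma exists_isStaircase {k N₁ N₂ : ℕ} (hk : 2 ≤ k) (h₁ : 2 * (k + 2) ^ 2 ≤ N₁)
    (h₂ : 2 * (k + 2) ^ 2 ≤ N₂) :
    ∃ R M₁ M₃ A B C, IsStaircase k R N₁ N₂ M₁ M₃ A B C ∧
      N₁ * N₂ ≤ k * (M₁ * N₁ + N₂ + M₃ * 6) := by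
  obtain ⟨j, rfl⟩ : ∃ j, k = j + 1 := ⟨k - 1, by omega⟩
  have hj : 1 ≤ j := by omega
  obtain ⟨R, q, hq, hN₂⟩ : ∃ R q, q < j ∧ N₂ = j * R + q :=
    ⟨N₂ / j, N₂ % j, Nat.mod_lt _ hj, (Nat.div_add_mod _ _).symm⟩
  have hR : 2 * j + 12 ≤ R := by
    by_contra! hlt
    have : j * R ≤ j * (2 * j + 11) := Nat.mul_le_mul_left _ (by omega)
    nlinarith
  have hR0 : 0 < R := by omega
  have hN₁ : 16 * j + 8 ≤ N₁ := by nlinarith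
  obtain ⟨X, hX⟩ : ∃ X, N₁ = X + (j + 1) := ⟨N₁ - (j + 1), by omega⟩
  obtain ⟨M₁, s, hs, hM₁⟩ : ∃ M s, s < N₁ ∧ R * X = N₁ * M + s :=
    ⟨R * X / N₁, R * X % N₁, Nat.mod_lt _ (by omega), (Nat.div_add_mod _ _).symm⟩
  obtain ⟨M₃, hM₃, hM₃'⟩ : ∃ M, R ≤ M * 6 ∧ M * 6 ≤ R + 5 :=
    ⟨(R + 5) / 6, by omega, by omega⟩
  obtain ⟨l, hl, hl'⟩ : ∃ l, N₁ + (j + 1) ≤ 2 * l ∧ 2 * l ≤ N₁ + (j + 1) + 1 :=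
    ⟨(N₁ + (j + 1) + 1) / 2, by omega, by omega⟩
  have hM₁l : R * l ≤ M₁ * N₁ := by
    obtain ⟨y, hy⟩ : ∃ y, X = l + y := ⟨X - l, by omega⟩
    have : 12 * y ≤ R * y := Nat.mul_le_mul_right _ (by omega)
    rw [hy, mul_add] at hM₁
    rw [mul_comm M₁]
    omega
  have hRj : 12 * (j + 1) ≤ j * R := by nlinarith
  refine ⟨R, M₁, M₃, fun r => r * (M₁ * N₁) / R, fun r => r * N₂ / R,
    fun r => r * (M₃ * 6) / R, ⟨by simp, beatty_add_period hR0, beatty_add_period hR0,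
      beatty_add_period hR0, fun r => ?_, fun r => ?_, fun r => ?_, fun r => ?_, fun r => ?_,
      fun r => ?_⟩, ?_⟩
  · have := add_le_beatty hR0 hM₁l r
    omega
  · have := beatty_add_le (u := X) (p := M₁ * N₁) hR0 (by rw [mul_comm M₁]; omega) r
    omega
  · have := add_le_beatty (l := j) (p := N₂) hR0 (by rw [mul_comm R]; omega) r
    omega
  · have := beatty_add_le (u := j + 1) (p := N₂) hR0 (by nlinarith) r
    omega
  · exact add_le_beatty hR0 (by omega) r
  · exact beatty_add_le hR0 (by omega) r
  · obtain ⟨Q, rfl⟩ : ∃ Q, R = Q + 1 := ⟨R - 1, by omega⟩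
    have hlen : Q * N₁ ≤ M₁ * N₁ + N₂ + M₃ * 6 := by
      subst hX
      nlinarith
    have hN₂Q : N₂ ≤ (j + 1) * Q := by nlinarith
    calc N₁ * N₂ ≤ N₁ * ((j + 1) * Q) := Nat.mul_le_mul_left _ hN₂Q
      _ = (j + 1) * (Q * N₁) := by ring
      _ ≤ _ := Nat.mul_le_mul_left _ hlen

lemma K_mul_K_le {k p q : ℕ} (hk : 2 ≤ k) (hp : (k + 2) ^ 2 ≤ p) (hq : (k + 2) ^ 2 ≤ q) :
    K p k * K q k ≤ k * K (p + q + 3) k := by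
  have hkp : k ≤ p := by nlinarith
  have hkq : k ≤ q := by nlinarith
  have hKp := two_mul_le_K (by omega) hkp (hk.trans hkp)
  have hKq := two_mul_le_K (by omega) hkq (hk.trans hkq)
  obtain ⟨g₁, h₁⟩ := exists_isPeriodicCode_K (by omega) hkp (hk.trans hkp)
  obtain ⟨g₂, h₂⟩ := exists_isPeriodicCode_K (by omega) hkq (hk.trans hkq)
  obtain ⟨g₃, h₃⟩ := exists_isPeriodicCode_two_mul 3 (by omega)
  obtain ⟨R, M₁, M₃, A, B, C, h, hL⟩ := exists_isStaircase (N₁ := K p k) (N₂ := K q k) hk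
    (by omega) (by omega)
  obtain ⟨g, hg⟩ := h.exists_isPeriodicCode hk h₁ h₂ h₃
  exact hL.trans (Nat.mul_le_mul_left _ (hg.le_K (by nlinarith) (by omega)))

/-- For even `k ≥ 2` and `n ≥ m ≥ (k+2)² + 3`,
`K(m−3,k)·K(n−3,k) ≤ k·K(m+n−3,k)`; equivalently, with
`a_n := log₂(K(n−3,k)/k)`, one has `a_m + a_n ≤ a_{m+n}`, i.e.
`log₂ K(d−3,k)` is superadditive in `d` up to an additive constant. -/
theorem stmt_6 (k m n : ℕ) (hk : 2 ≤ k) (hke : Even k)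
    (hm : (k + 2) ^ 2 + 3 ≤ m) (hmn : m ≤ n) :
    K (m - 3) k * K (n - 3) k ≤ k * K (m + n - 3) k ∧
    Real.logb 2 ((K (m - 3) k : ℝ) / k) + Real.logb 2 ((K (n - 3) k : ℝ) / k) ≤
      Real.logb 2 ((K (m + n - 3) k : ℝ) / k) := by
  obtain ⟨p, rfl⟩ : ∃ p, m = p + 3 := ⟨m - 3, by omega⟩
  obtain ⟨q, rfl⟩ : ∃ q, n = q + 3 := ⟨n - 3, by omega⟩
  have hp : (k + 2) ^ 2 ≤ p := by omega
  have hq : (k + 2) ^ 2 ≤ q := by omega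
  have hkp : k ≤ p := by nlinarith
  have hkq : k ≤ q := by nlinarith
  rw [show p + 3 + (q + 3) - 3 = p + q + 3 by omega, Nat.add_sub_cancel, Nat.add_sub_cancel]
  have hK := K_mul_K_le hk hp hq
  refine ⟨hK, ?_⟩
  have hKp := two_mul_le_K (by omega) hkp (hk.trans hkp)
  have hKq := two_mul_le_K (by omega) hkq (hk.trans hkq)
  have hk0 : (0 : ℝ) < k := by exact_mod_cast (show 0 < k by omega)
  have hp0 : (0 : ℝ) < K p k := by exact_mod_cast (show 0 < K p k by omega)
  have hq0 : (0 : ℝ) < K q k := by exact_mod_cast (show 0 < K q k by omega)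
  have hK' : (K p k : ℝ) * K q k ≤ k * K (p + q + 3) k := by exact_mod_cast hK
  rw [← Real.logb_mul (by positivity) (by positivity)]
  refine Real.logb_le_logb_of_le (by norm_num) (by positivity) ?_
  rw [div_mul_div_comm, div_le_div_iff₀ (by positivity) hk0]
  nlinarith
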